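/- Consider a non-stationary K-armed bandit satisfying Assumption A2 with constants θ, ξ, η (with θ chosen large enough that 2θ^{1/ξ}/Δ_min > 1), run with the UCB-ERM algorithm with parameter α > 2. Let A(t) = ⌈((2/Δ_min) θ^{1/ξ} t^{α/ξ})^{1/(1−η)}⌉, let N_p = min{t ∈ ℕ : t ≥ A(t)}, and let ρ̄_n = (1/n) Σ_{i=1}^K T_i(n) ρ̂_{i,T_i(n)}. Then for every n ≥ N_p and every x ≥ 1, setting r_0 = n^η + 2(R + (exp(2βR) − 1)/(2β))(K−1)(3 + A(n)), one has P[n ρ̄_n − n μ* ≥ r_0 x] ≤ θ/x^ξ + 2(K−1)/((α−1)((1 + A(n)) x)^{α−1}) and P[n ρ̄_n − n μ* ≤ −r_0 x] ≤ θ/x^ξ + 2(K−1)/((α−1)((1 + A(n)) x)^{α−1}). -/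

import Mathlib

open MeasureTheory ProbabilityTheory Filter

/-- The empirical ERM_β estimator `ρ̂_n = (1/β) ln((1/n) Σ_{t<n} exp(β x_t))` (the sum runs
over the first `n` samples). -/
noncomputable def ermEst (β : ℝ) (n : ℕ) (x : ℕ → ℝ) : ℝ :=
  (1 / β) * Real.log ((1 / (n : ℝ)) * ∑ t ∈ Finset.range n, Real.exp (β * x t))

/-- The UCB exploration bonus `b_{t,s} = θ^{1/ξ} t^{α/ξ} / s^{1−η}`. -/
noncomputable def bonus (θ ξ η α : ℝ) (t s : ℕ) : ℝ :=
  θ ^ (1 / ξ) * (t : ℝ) ^ (α / ξ) / (s : ℝ) ^ (1 - η)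

/-- `pulls a i t ω` : the number of pulls `T_i(t)` of arm `i` up to and including round `t`
(rounds are indexed `1, 2, …`). -/
def pulls {Ω : Type*} {K : ℕ} (a : ℕ → Ω → Fin K) (i : Fin K) (t : ℕ) (ω : Ω) : ℕ :=
  ((Finset.Icc 1 t).filter fun s => a s ω = i).card

/-- `A(t) = ⌈((2/Δ) θ^{1/ξ} t^{α/ξ})^{1/(1−η)}⌉`. -/
noncomputable def Athresh (θ ξ η α Δ : ℝ) (t : ℕ) : ℕ :=
  ⌈((2 / Δ) * θ ^ (1 / ξ) * (t : ℝ) ^ (α / ξ)) ^ (1 / (1 - η))⌉₊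

/-- The mean of `exp (β x_t)` over the first `n ≥ 1` samples lies in `[exp (-βR), exp (βR)]`. -/
lemma exp_mean_mem {β R : ℝ} (hβ : 0 < β) {x : ℕ → ℝ} (hx : ∀ t, x t ∈ Set.Icc (-R) R)
    {n : ℕ} (hn : 1 ≤ n) :
    (1 / (n : ℝ)) * ∑ t ∈ Finset.range n, Real.exp (β * x t) ∈
      Set.Icc (Real.exp (-(β * R))) (Real.exp (β * R)) := by
  have hn0 : (0 : ℝ) < n := by exact_mod_cast hn
  have h1 : ∑ t ∈ Finset.range n, Real.exp (-(β * R)) ≤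
      ∑ t ∈ Finset.range n, Real.exp (β * x t) :=
    Finset.sum_le_sum fun t _ => Real.exp_le_exp.2 (by nlinarith [(hx t).1])
  have h2 : ∑ t ∈ Finset.range n, Real.exp (β * x t) ≤
      ∑ t ∈ Finset.range n, Real.exp (β * R) :=
    Finset.sum_le_sum fun t _ => Real.exp_le_exp.2 (by nlinarith [(hx t).2])
  simp only [Finset.sum_const, Finset.card_range, nsmul_eq_mul] at h1 h2
  rw [one_div_mul_eq_div]
  exact ⟨(le_div_iff₀ hn0).2 (by linarith), (div_le_iff₀ hn0).2 (by linarith)⟩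

lemma abs_ermEst_le {β R : ℝ} (hβ : 0 < β) {x : ℕ → ℝ} (hx : ∀ t, x t ∈ Set.Icc (-R) R)
    {n : ℕ} (hn : 1 ≤ n) : |ermEst β n x| ≤ R := by
  obtain ⟨h1, h2⟩ := exp_mean_mem hβ hx hn
  have h0 := (Real.exp_pos _).trans_le h1
  have h3 := (Real.le_log_iff_exp_le h0).2 h1
  have h4 := (Real.log_le_iff_le_exp h0).2 h2
  rw [ermEst, one_div_mul_eq_div, abs_le]
  exact ⟨(le_div_iff₀ hβ).2 (by linarith), (div_le_iff₀ hβ).2 (by linarith)⟩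

lemma abs_natCast_mul_ermEst_le {β R : ℝ} (hβ : 0 < β) {x : ℕ → ℝ}
    (hx : ∀ t, x t ∈ Set.Icc (-R) R) (n : ℕ) : |(n : ℝ) * ermEst β n x| ≤ n * R := by
  rcases Nat.eq_zero_or_pos n with rfl | hn
  · simp
  · rw [abs_mul, Nat.abs_cast]
    exact mul_le_mul_of_nonneg_left (abs_ermEst_le hβ hx hn) (Nat.cast_nonneg _)

lemma abs_log_sub_log_le {c p q : ℝ} (hc : 0 < c) (hp : c ≤ p) (hq : c ≤ q) :
    |Real.log p - Real.log q| ≤ |p - q| / c := by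
  have key : ∀ u v : ℝ, c ≤ u → c ≤ v → Real.log u - Real.log v ≤ |u - v| / c := by
    intro u v hu hv
    have hu0 := hc.trans_le hu
    have hv0 := hc.trans_le hv
    rw [← Real.log_div hu0.ne' hv0.ne']
    calc Real.log (u / v) ≤ u / v - 1 := Real.log_le_sub_one_of_pos (by positivity)
      _ = (u - v) / v := by field_simp
      _ ≤ |u - v| / v := by gcongr; exact le_abs_self _
      _ ≤ |u - v| / c := by gcongr
  rw [abs_le]
  have h1 := key p q hp hq
  have h2 := key q p hq hp
  rw [abs_sub_comm] at h2
  constructor <;> linarith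

/-- Lipschitz-type control of `n ρ̂_n` in the number of samples. -/
lemma abs_mul_ermEst_sub_le {β R : ℝ} (hβ : 0 < β) {x : ℕ → ℝ}
    (hx : ∀ t, x t ∈ Set.Icc (-R) R) {m n : ℕ} (hmn : m ≤ n) :
    |(m : ℝ) * ermEst β m x - n * ermEst β n x| ≤
      ((n : ℝ) - m) * (R + (Real.exp (2 * β * R) - 1) / β) := by
  have hR : 0 ≤ R := by have := hx 0; linarith [this.1, this.2]
  have he : 0 ≤ (Real.exp (2 * β * R) - 1) / β :=
    div_nonneg (by linarith [Real.one_le_exp (show 0 ≤ 2 * β * R by positivity)]) hβ.le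
  have hmn' : (m : ℝ) ≤ n := by exact_mod_cast hmn
  rcases Nat.eq_zero_or_pos m with rfl | hm
  · have h := abs_natCast_mul_ermEst_le hβ hx n
    simp only [Nat.cast_zero, zero_mul, zero_sub, abs_neg, sub_zero]
    refine h.trans ?_
    gcongr
    linarith
  have hn : 1 ≤ n := hm.trans_le hmn
  have hn0 : (0 : ℝ) < n := by exact_mod_cast hn
  have hm0 : (0 : ℝ) < m := by exact_mod_cast hm
  have hE := abs_ermEst_le hβ hx hn
  have hp := exp_mean_mem hβ hx hm
  have hq := exp_mean_mem hβ hx hn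
  set p := (1 / (m : ℝ)) * ∑ t ∈ Finset.range m, Real.exp (β * x t) with hpdef
  set q := (1 / (n : ℝ)) * ∑ t ∈ Finset.range n, Real.exp (β * x t) with hqdef
  have hlog := abs_log_sub_log_le (Real.exp_pos _) hp.1 hq.1
  have hnq : (n : ℝ) * q = m * p + ∑ t ∈ Finset.Ico m n, Real.exp (β * x t) := by
    rw [hpdef, hqdef, ← Finset.sum_range_add_sum_Ico _ hmn]
    field_simp
  have h1 : ((n : ℝ) - m) * Real.exp (-(β * R)) ≤
      ∑ t ∈ Finset.Ico m n, Real.exp (β * x t) := by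
    have : ∑ t ∈ Finset.Ico m n, Real.exp (-(β * R)) ≤
        ∑ t ∈ Finset.Ico m n, Real.exp (β * x t) :=
      Finset.sum_le_sum fun t _ => Real.exp_le_exp.2 (by nlinarith [(hx t).1])
    simpa [Nat.cast_sub hmn] using this
  have h2 : ∑ t ∈ Finset.Ico m n, Real.exp (β * x t) ≤
      ((n : ℝ) - m) * Real.exp (β * R) := by
    have : ∑ t ∈ Finset.Ico m n, Real.exp (β * x t) ≤
        ∑ t ∈ Finset.Ico m n, Real.exp (β * R) :=
      Finset.sum_le_sum fun t _ => Real.exp_le_exp.2 (by nlinarith [(hx t).2])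
    simpa [Nat.cast_sub hmn] using this
  have h3 : (n : ℝ) * |p - q| ≤
      ((n : ℝ) - m) * (Real.exp (β * R) - Real.exp (-(β * R))) := by
    rw [← abs_of_pos hn0, ← abs_mul, abs_of_pos hn0, abs_le]
    constructor <;> nlinarith [hp.1, hp.2]
  have h4 : (m : ℝ) * |Real.log p - Real.log q| ≤
      ((n : ℝ) - m) * (Real.exp (2 * β * R) - 1) := by
    have hsplit : Real.exp (2 * β * R) - 1 =
        (Real.exp (β * R) - Real.exp (-(β * R))) / Real.exp (-(β * R)) := by
      rw [sub_div, div_self (Real.exp_pos _).ne', ← Real.exp_sub]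
      ring_nf
    calc (m : ℝ) * |Real.log p - Real.log q|
        ≤ n * (|p - q| / Real.exp (-(β * R))) := by gcongr
      _ = (n * |p - q|) / Real.exp (-(β * R)) := by ring
      _ ≤ _ := by
        rw [hsplit, ← mul_div_assoc]
        gcongr
  have h5 : (m : ℝ) * ermEst β m x - n * ermEst β n x =
      m * (Real.log p - Real.log q) / β - ((n : ℝ) - m) * ermEst β n x := by
    simp only [ermEst, ← hpdef, ← hqdef]
    ring
  rw [h5]
  calc |m * (Real.log p - Real.log q) / β - ((n : ℝ) - m) * ermEst β n x|
      ≤ |m * (Real.log p - Real.log q) / β| + |((n : ℝ) - m) * ermEst β n x| := abs_sub _ _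
    _ = m * |Real.log p - Real.log q| / β + ((n : ℝ) - m) * |ermEst β n x| := by
        rw [abs_div, abs_mul, abs_mul, abs_of_pos hβ, abs_of_pos hm0,
          abs_of_nonneg (sub_nonneg.2 hmn')]
    _ ≤ ((n : ℝ) - m) * (Real.exp (2 * β * R) - 1) / β + ((n : ℝ) - m) * R := by
        gcongr
    _ = _ := by ring

section Pulls

variable {Ω : Type*} {K : ℕ} (a : ℕ → Ω → Fin K) (ω : Ω)

lemma pulls_succ (i : Fin K) (t : ℕ) :
    pulls a i (t + 1) ω = pulls a i t ω + if a (t + 1) ω = i then 1 else 0 := by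
  unfold pulls
  rw [← Finset.insert_Icc_right_eq_Icc_add_one (by omega), Finset.filter_insert]
  split_ifs with h
  · rw [Finset.card_insert_of_notMem (by simp)]
  · rfl

lemma sum_pulls (t : ℕ) : ∑ i, pulls a i t ω = t := by
  simpa [pulls] using (Finset.card_eq_sum_card_fiberwise (s := Finset.Icc 1 t)
    (t := Finset.univ) (f := fun s => a s ω) (by simp)).symm

lemma pulls_le (i : Fin K) (t : ℕ) : pulls a i t ω ≤ t :=
  (Finset.single_le_sum (f := fun i => pulls a i t ω) (fun _ _ => Nat.zero_le _)
    (Finset.mem_univ i)).trans_eq (sum_pulls a ω t)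

lemma pulls_add_pulls_le {i j : Fin K} (hij : i ≠ j) (t : ℕ) :
    pulls a i t ω + pulls a j t ω ≤ t := by
  rw [← Finset.sum_pair (f := fun i => pulls a i t ω) hij]
  exact (Finset.sum_le_sum_of_subset (Finset.subset_univ _)).trans_eq (sum_pulls a ω t)

lemma exists_pull_of_lt_pulls {i : Fin K} {u n : ℕ} (h : u < pulls a i n ω) :
    ∃ t < n, a (t + 1) ω = i ∧ pulls a i t ω = u := by
  induction n with
  | zero => simp [pulls] at h
  | succ n ih =>
    by_cases hn : u < pulls a i n ω
    · obtain ⟨t, ht, h'⟩ := ih hn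
      exact ⟨t, by omega, h'⟩
    · rw [pulls_succ] at h
      split_ifs at h with ha
      · exact ⟨n, by omega, ha, by omega⟩
      · omega

lemma one_le_pulls_of_le (hinit : ∀ t, 1 ≤ t → t ≤ K → (a t ω : ℕ) = t - 1) (i : Fin K) {t : ℕ}
    (ht : K ≤ t) : 1 ≤ pulls a i t ω := by
  refine Finset.card_pos.2 ⟨i + 1, ?_⟩
  have := i.2
  simp only [Finset.mem_filter, Finset.mem_Icc]
  exact ⟨by omega, Fin.ext (by rw [hinit _ (by omega) (by omega)]; omega)⟩

lemma le_of_one_le_pulls_of_pull (hinit : ∀ t, 1 ≤ t → t ≤ K → (a t ω : ℕ) = t - 1) {i : Fin K}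
    {t : ℕ} (ha : a (t + 1) ω = i) (h : 1 ≤ pulls a i t ω) : K ≤ t := by
  by_contra! hlt
  obtain ⟨s, hs⟩ := Finset.card_pos.1 h
  simp only [Finset.mem_filter, Finset.mem_Icc] at hs
  have h1 := hinit s hs.1.1 (by omega)
  have h2 := hinit (t + 1) (by omega) (by omega)
  rw [hs.2] at h1
  rw [ha] at h2
  omega

end Pulls

/-- Comparison of one term of the `p`-series with the integral over the preceding interval. -/
lemma rpow_neg_le_sub {α y : ℝ} (hα : 2 < α) (hy : 0 < y) :
    (y + 1) ^ (-α) ≤ (y ^ (1 - α) - (y + 1) ^ (1 - α)) / (α - 1) := by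
  have hy1 : 0 < y + 1 := by linarith
  rw [le_div_iff₀ (by linarith)]
  have hB : 1 + (α - 1) * (1 / y) ≤ (1 + 1 / y) ^ (α - 1) :=
    one_add_mul_self_le_rpow_one_add (by have := one_div_pos.2 hy; linarith) (by linarith)
  have h1 : y ^ (1 - α) = (1 + 1 / y) ^ (α - 1) * (y + 1) ^ (1 - α) := by
    rw [show 1 + 1 / y = (y + 1) / y by field_simp, Real.div_rpow hy1.le hy.le,
      show 1 - α = -(α - 1) by ring, Real.rpow_neg hy.le, Real.rpow_neg hy1.le]
    have := Real.rpow_pos_of_pos hy1 (α - 1)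
    field_simp
  have h2 : (y + 1) ^ (-α) = (y + 1) ^ (1 - α) * (1 / (y + 1)) := by
    rw [show 1 - α = -α + 1 by ring, Real.rpow_add_one hy1.ne']
    field_simp
  have h3 : 1 / (y + 1) ≤ 1 / y := by gcongr; linarith
  rw [h1, h2]
  have h4 := Real.rpow_pos_of_pos hy1 (1 - α)
  nlinarith [mul_le_mul_of_nonneg_left h3 (show 0 ≤ α - 1 by linarith)]

lemma sum_rpow_neg_le {α y : ℝ} (hα : 2 < α) (hy : 0 < y) (m : ℕ) :
    ∑ s ∈ Finset.range m, (y + s + 1) ^ (-α) ≤ y ^ (1 - α) / (α - 1) := by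
  have h : ∑ s ∈ Finset.range m, (y + s + 1) ^ (-α) ≤
      (y ^ (1 - α) - (y + m) ^ (1 - α)) / (α - 1) := by
    induction m with
    | zero => simp
    | succ m ih =>
      rw [Finset.sum_range_succ]
      have := rpow_neg_le_sub hα (show 0 < y + m by positivity)
      push_cast
      rw [← add_assoc]
      calc _ ≤ _ := add_le_add ih this
        _ = _ := by ring
  refine h.trans ?_
  have : 0 < α - 1 := by linarith
  gcongr
  linarith [Real.rpow_nonneg (show 0 ≤ y + m by positivity) (1 - α)]

lemma bonus_le_bonus {θ ξ α : ℝ} (η : ℝ) (hθ : 1 < θ) (hξ : 1 < ξ) (hα : 2 < α) {t t' : ℕ}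
    (h : t ≤ t') (s : ℕ) : bonus θ ξ η α t s ≤ bonus θ ξ η α t' s := by
  have : 0 ≤ α / ξ := by positivity
  unfold bonus
  gcongr

lemma natCast_mul_bonus (θ ξ η α : ℝ) (t : ℕ) {s : ℕ} (hs : 1 ≤ s) :
    (s : ℝ) * bonus θ ξ η α t s = (s : ℝ) ^ η * (θ ^ (1 / ξ) * (t : ℝ) ^ (α / ξ)) := by
  have hs0 : (0 : ℝ) < s := by exact_mod_cast hs
  rw [bonus, Real.rpow_sub hs0, Real.rpow_one]
  have := Real.rpow_pos_of_pos hs0 η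
  field_simp

lemma one_le_bonus_coeff {θ ξ α : ℝ} (hθ : 1 < θ) (hξ : 1 < ξ) (hα : 2 < α) {t : ℕ} (ht : 1 ≤ t) :
    1 ≤ θ ^ (1 / ξ) * (t : ℝ) ^ (α / ξ) :=
  one_le_mul_of_one_le_of_one_le (Real.one_le_rpow hθ.le (by positivity))
    (Real.one_le_rpow (by exact_mod_cast ht) (by positivity))

lemma div_bonus_coeff_rpow {θ ξ : ℝ} (α : ℝ) (hθ : 1 < θ) (hξ : 1 < ξ) (t : ℕ) :
    θ / (θ ^ (1 / ξ) * (t : ℝ) ^ (α / ξ)) ^ ξ = (t : ℝ) ^ (-α) := by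
  have hξ0 : ξ ≠ 0 := by positivity
  rw [Real.mul_rpow (by positivity) (by positivity), ← Real.rpow_mul (by positivity),
    ← Real.rpow_mul (by positivity), one_div_mul_cancel hξ0, div_mul_cancel₀ _ hξ0,
    Real.rpow_one, Real.rpow_neg (by positivity)]
  field_simp

lemma bonus_le_half_of_Athresh_le {θ ξ η α Δ : ℝ} (hθ : 1 < θ) (hη1 : η < 1) (hΔ : 0 < Δ)
    {n u : ℕ} (hu : 1 ≤ u) (h : Athresh θ ξ η α Δ n ≤ u) : bonus θ ξ η α n u ≤ Δ / 2 := by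
  have hu0 : (0 : ℝ) < u := by exact_mod_cast hu
  have h1 := Nat.ceil_le.1 h
  have hη' : 0 < 1 - η := by linarith
  rw [one_div (1 - η), Real.rpow_inv_le_iff_of_pos (by positivity) hu0.le hη'] at h1
  rw [bonus, div_le_iff₀ (Real.rpow_pos_of_pos hu0 _)]
  calc θ ^ (1 / ξ) * (n : ℝ) ^ (α / ξ)
      = Δ / 2 * (2 / Δ * θ ^ (1 / ξ) * (n : ℝ) ^ (α / ξ)) := by field_simp
    _ ≤ _ := by gcongr

/-- If a suboptimal arm `i` is pulled more than `u` times, then either its index after `u` pulls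
fails to exceed the optimal value, or some index of the optimal arm overshoots it. -/
lemma index_deviation_of_lt_pulls {Ω : Type*} {K : ℕ} {β θ ξ η α : ℝ} {x : Fin K → ℕ → Ω → ℝ}
    (hθ : 1 < θ) (hξ : 1 < ξ) (hα : 2 < α) {a : ℕ → Ω → Fin K} {ω : Ω}
    (hinit : ∀ t, 1 ≤ t → t ≤ K → (a t ω : ℕ) = t - 1)
    (hsel : ∀ t, K < t → ∀ i : Fin K,
      ermEst β (pulls a (a t ω) (t - 1) ω) (fun u => x (a t ω) u ω)
          - bonus θ ξ η α t (pulls a (a t ω) (t - 1) ω)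
        ≤ ermEst β (pulls a i (t - 1) ω) (fun u => x i u ω)
          - bonus θ ξ η α t (pulls a i (t - 1) ω))
    {i j : Fin K} (hij : i ≠ j) (m : ℝ) {u n : ℕ} (hu : 1 ≤ u) (h : u < pulls a i n ω) :
    ermEst β u (fun t => x i t ω) - bonus θ ξ η α n u ≤ m ∨
      ∃ s < n, m < ermEst β (s + 1) (fun t => x j t ω) - bonus θ ξ η α (u + s + 1) (s + 1) := by
  obtain ⟨t, htn, hat, hpt⟩ := exists_pull_of_lt_pulls a ω h
  have hKt := le_of_one_le_pulls_of_pull a ω hinit hat (by omega)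
  have hj := one_le_pulls_of_le a ω hinit j hKt
  have hle := pulls_add_pulls_le a ω hij t
  have hs := hsel (t + 1) (by omega) j
  rw [hat, Nat.add_sub_cancel, hpt] at hs
  obtain ⟨s, hs'⟩ := Nat.exists_eq_add_of_le' hj
  rw [hs'] at hs hle
  by_contra! hcon
  have h1 := hcon.2 s (by omega)
  have h2 := bonus_le_bonus η hθ hξ hα (show u + s + 1 ≤ t + 1 by omega) (s + 1)
  have h3 := bonus_le_bonus η hθ hξ hα (show t + 1 ≤ n by omega) u
  linarith [hcon.1]

/-- Tail bound for the number of pulls of a suboptimal arm. -/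
lemma measure_le_pulls_le {Ω : Type*} [MeasurableSpace Ω] (P : Measure Ω)
    {K : ℕ} {β : ℝ} {x : Fin K → ℕ → Ω → ℝ}
    {θ ξ η α : ℝ} (hθ : 1 < θ) (hξ : 1 < ξ) (hη1 : η < 1) (hα : 2 < α)
    {μ : Fin K → ℝ} {i j : Fin K} (hij : i ≠ j) {Δ : ℝ} (hΔ0 : 0 < Δ) (hΔ : Δ ≤ μ i - μ j)
    (hconcU : ∀ n : ℕ, 1 ≤ n → ∀ z : ℝ, 1 ≤ z →
      P {ω | (n : ℝ) ^ η * z ≤ (n : ℝ) * ermEst β n (fun t => x j t ω) - (n : ℝ) * μ j}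
        ≤ ENNReal.ofReal (θ / z ^ ξ))
    (hconcL : ∀ n : ℕ, 1 ≤ n → ∀ z : ℝ, 1 ≤ z →
      P {ω | (n : ℝ) * ermEst β n (fun t => x i t ω) - (n : ℝ) * μ i ≤ -((n : ℝ) ^ η * z)}
        ≤ ENNReal.ofReal (θ / z ^ ξ))
    {a : ℕ → Ω → Fin K}
    (hinit : ∀ ω, ∀ t, 1 ≤ t → t ≤ K → ((a t ω : ℕ) = t - 1))
    (hsel : ∀ ω, ∀ t, K < t → ∀ i : Fin K,
      ermEst β (pulls a (a t ω) (t - 1) ω) (fun u => x (a t ω) u ω)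
          - bonus θ ξ η α t (pulls a (a t ω) (t - 1) ω)
        ≤ ermEst β (pulls a i (t - 1) ω) (fun u => x i u ω)
          - bonus θ ξ η α t (pulls a i (t - 1) ω))
    (n : ℕ) {y : ℝ} (hy : 1 ≤ y) :
    P {ω | (3 + (Athresh θ ξ η α Δ n : ℝ)) * y ≤ pulls a i n ω} ≤
      ENNReal.ofReal (2 / ((α - 1) * ((1 + (Athresh θ ξ η α Δ n : ℝ)) * y) ^ (α - 1))) := by
  set A := Athresh θ ξ η α Δ n with hA
  have hA0 : (0 : ℝ) ≤ A := Nat.cast_nonneg _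
  obtain ⟨u, hu⟩ := Nat.exists_eq_add_of_le'
    (Nat.one_le_ceil_iff.2 (show 0 < (3 + (A : ℝ)) * y by positivity))
  have huy : (3 + (A : ℝ)) * y ≤ u + 1 := by exact_mod_cast hu ▸ Nat.le_ceil ((3 + (A : ℝ)) * y)
  have hwu : (1 + (A : ℝ)) * y ≤ u := by nlinarith
  have hw : 1 ≤ (1 + (A : ℝ)) * y := by nlinarith
  have hAu : A ≤ u := by
    have : (A : ℝ) ≤ u := by nlinarith
    exact_mod_cast this
  have hu1 : 1 ≤ u := by exact_mod_cast hw.trans hwu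
  have hsub : {ω | (3 + (A : ℝ)) * y ≤ pulls a i n ω} ⊆ {ω | u < pulls a i n ω} := by
    intro ω hω
    rw [Set.mem_ofPred_eq] at hω
    have := Nat.ceil_le.2 hω
    rw [Set.mem_ofPred_eq]
    omega
  rcases Nat.lt_or_ge u n with hun | hun
  swap
  · rw [Set.eq_empty_of_subset_empty (hsub.trans fun ω hω => ?_)]
    · simp
    · exact absurd (pulls_le a ω i n) (by have : u < pulls a i n ω := hω; omega)
  have hn1 : 1 ≤ n := by omega
  have hcover : {ω | u < pulls a i n ω} ⊆
      {ω | (u : ℝ) * ermEst β u (fun t => x i t ω) - (u : ℝ) * μ i ≤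
        -((u : ℝ) ^ η * (θ ^ (1 / ξ) * (n : ℝ) ^ (α / ξ)))} ∪
      ⋃ s ∈ Finset.range n, {ω | ((s + 1 : ℕ) : ℝ) ^ η *
          (θ ^ (1 / ξ) * ((u + s + 1 : ℕ) : ℝ) ^ (α / ξ)) ≤
        ((s + 1 : ℕ) : ℝ) * ermEst β (s + 1) (fun t => x j t ω) - ((s + 1 : ℕ) : ℝ) * μ j} := by
    intro ω hω
    rcases index_deviation_of_lt_pulls hθ hξ hα (hinit ω) (hsel ω) hij (μ j) hu1 hω with
      h | ⟨s, hs, h⟩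
    · refine Or.inl ?_
      have hb := bonus_le_half_of_Athresh_le hθ hη1 hΔ0 hu1 hAu
      rw [Set.mem_ofPred_eq, ← natCast_mul_bonus _ _ _ _ _ hu1, ← mul_sub, ← mul_neg]
      exact mul_le_mul_of_nonneg_left (by linarith) (Nat.cast_nonneg _)
    · refine Or.inr (Set.mem_biUnion (Finset.mem_coe.2 (Finset.mem_range.2 hs)) ?_)
      rw [Set.mem_ofPred_eq, ← natCast_mul_bonus _ _ _ _ _ (Nat.le_add_left 1 s), ← mul_sub]
      exact mul_le_mul_of_nonneg_left (by linarith) (Nat.cast_nonneg _)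
  have hα1 : 0 < α - 1 := by linarith
  have hu0 : (0 : ℝ) < u := by exact_mod_cast hu1
  have hfirst : (n : ℝ) ^ (-α) ≤ (u : ℝ) ^ (1 - α) / (α - 1) := by
    have hn : (u : ℝ) ≤ (n : ℝ) - 1 := by
      have : (u : ℝ) + 1 ≤ n := by exact_mod_cast hun
      linarith
    have h := rpow_neg_le_sub hα (hu0.trans_le hn)
    rw [sub_add_cancel] at h
    refine h.trans ?_
    gcongr
    have h1 := Real.rpow_le_rpow_of_nonpos hu0 hn (show 1 - α ≤ 0 by linarith)
    linarith [Real.rpow_nonneg (Nat.cast_nonneg (α := ℝ) n) (1 - α)]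
  calc P {ω | (3 + (A : ℝ)) * y ≤ pulls a i n ω}
      ≤ _ := measure_mono (hsub.trans hcover)
    _ ≤ _ := measure_union_le _ _
    _ ≤ ENNReal.ofReal ((n : ℝ) ^ (-α)) +
        ∑ s ∈ Finset.range n, ENNReal.ofReal (((u : ℝ) + s + 1) ^ (-α)) := by
      refine add_le_add ?_ ((measure_biUnion_finset_le _ _).trans (Finset.sum_le_sum fun s _ => ?_))
      · rw [← div_bonus_coeff_rpow α hθ hξ]
        exact hconcL u hu1 _ (one_le_bonus_coeff hθ hξ hα hn1)
      · have := hconcU (s + 1) (by omega) _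
          (one_le_bonus_coeff hθ hξ hα (show 1 ≤ u + s + 1 by omega))
        rw [div_bonus_coeff_rpow α hθ hξ] at this
        exact_mod_cast this
    _ = ENNReal.ofReal ((n : ℝ) ^ (-α) + ∑ s ∈ Finset.range n, ((u : ℝ) + s + 1) ^ (-α)) := by
      rw [ENNReal.ofReal_add (by positivity) (Finset.sum_nonneg fun s _ => by positivity),
        ENNReal.ofReal_sum_of_nonneg fun s _ => by positivity]
    _ ≤ _ := by
      refine ENNReal.ofReal_le_ofReal ((add_le_add hfirst (sum_rpow_neg_le hα hu0 n)).trans ?_)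
      have h1 := Real.rpow_le_rpow_of_nonpos (by linarith) hwu (show 1 - α ≤ 0 by linarith)
      have h2 : 2 / ((α - 1) * ((1 + (A : ℝ)) * y) ^ (α - 1)) =
          2 * (((1 + (A : ℝ)) * y) ^ (1 - α) / (α - 1)) := by
        rw [show 1 - α = -(α - 1) by ring, Real.rpow_neg (by positivity)]
        field_simp
      rw [h2, ← two_mul]
      gcongr

/-- The total cost of a policy differs from that of always pulling the arm `j` by at most a
constant times the number of pulls of the other arms. -/
lemma abs_sum_pulls_mul_ermEst_sub_le {Ω : Type*} {K : ℕ} {β R : ℝ} (hβ : 0 < β)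
    {x : Fin K → ℕ → Ω → ℝ} {ω : Ω} (hx : ∀ i t, x i t ω ∈ Set.Icc (-R) R)
    (a : ℕ → Ω → Fin K) (j : Fin K) (n : ℕ) :
    |∑ i, (pulls a i n ω : ℝ) * ermEst β (pulls a i n ω) (fun t => x i t ω)
        - n * ermEst β n (fun t => x j t ω)| ≤
      2 * (R + (Real.exp (2 * β * R) - 1) / (2 * β)) *
        ∑ i ∈ Finset.univ.erase j, (pulls a i n ω : ℝ) := by
  have hsum : (n : ℝ) - pulls a j n ω = ∑ i ∈ Finset.univ.erase j, (pulls a i n ω : ℝ) := by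
    rw [sub_eq_iff_eq_add, Finset.sum_erase_add _ _ (Finset.mem_univ j)]
    exact_mod_cast (sum_pulls a ω n).symm
  have h1 := abs_mul_ermEst_sub_le hβ (hx j) (pulls_le a ω j n)
  have h2 : |∑ i ∈ Finset.univ.erase j,
      (pulls a i n ω : ℝ) * ermEst β (pulls a i n ω) (fun t => x i t ω)| ≤
      (∑ i ∈ Finset.univ.erase j, (pulls a i n ω : ℝ)) * R := by
    rw [Finset.sum_mul]
    exact (Finset.abs_sum_le_sum_abs _ _).trans
      (Finset.sum_le_sum fun i _ => abs_natCast_mul_ermEst_le hβ (hx i) _)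
  rw [← Finset.sum_erase_add _ _ (Finset.mem_univ j), add_sub_assoc]
  refine (abs_add_le _ _).trans ((add_le_add h2 h1).trans_eq ?_)
  rw [hsum]
  field_simp
  ring

/-- Lemma 3: on a non-stationary `K`-armed bandit satisfying Assumption A2
(with `2θ^{1/ξ}/Δ_min > 1`), run with UCB-ERM with `α > 2`, for every `n ≥ N_p` and `x ≥ 1`,
with `r_0 = n^η + 2(R + (exp(2βR)−1)/(2β))(K−1)(3 + A(n))`, the deviations of
`n ρ̄_n` from `n μ*` beyond `r_0 x` have probability at most
`θ/x^ξ + 2(K−1)/((α−1)((1+A(n))x)^{α−1})` in both directions. -/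
theorem stmt9 {Ω : Type*} [MeasurableSpace Ω] (P : Measure Ω) [IsProbabilityMeasure P]
    (K : ℕ) (hK : 1 ≤ K) (R β : ℝ) (hR : 0 < R) (hβ : 0 < β)
    (x : Fin K → ℕ → Ω → ℝ) (hxmeas : ∀ i t, Measurable (x i t))
    (hxbdd : ∀ i t ω, x i t ω ∈ Set.Icc (-R) R)
    (θ ξ η α : ℝ) (hθ : 1 < θ) (hξ : 1 < ξ) (hη : 1 / 2 ≤ η) (hη1 : η < 1) (hα2 : 2 < α)
    (μ : Fin K → ℝ)
    (hconv : ∀ i, Tendsto (fun n => ∫ ω, ermEst β n (fun t => x i t ω) ∂P) atTop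
      (nhds (μ i)))
    (hconcU : ∀ i, ∀ n : ℕ, 1 ≤ n → ∀ z : ℝ, 1 ≤ z →
      P {ω | (n : ℝ) ^ η * z ≤ (n : ℝ) * ermEst β n (fun t => x i t ω) - (n : ℝ) * μ i}
        ≤ ENNReal.ofReal (θ / z ^ ξ))
    (hconcL : ∀ i, ∀ n : ℕ, 1 ≤ n → ∀ z : ℝ, 1 ≤ z →
      P {ω | (n : ℝ) * ermEst β n (fun t => x i t ω) - (n : ℝ) * μ i ≤ -((n : ℝ) ^ η * z)}
        ≤ ENNReal.ofReal (θ / z ^ ξ))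
    (istar : Fin K) (hstar : ∀ i, i ≠ istar → μ istar < μ i)
    (Δmin : ℝ) (hΔ : IsLeast {d | ∃ i, i ≠ istar ∧ d = μ i - μ istar} Δmin)
    -- `θ` is large enough that `2 θ^{1/ξ} / Δ_min > 1`
    (hθbig : 1 < 2 * θ ^ (1 / ξ) / Δmin)
    (a : ℕ → Ω → Fin K) (hameas : ∀ t, Measurable (a t))
    (hinit : ∀ ω, ∀ t, 1 ≤ t → t ≤ K → ((a t ω : ℕ) = t - 1))
    (hsel : ∀ ω, ∀ t, K < t → ∀ i : Fin K,
      ermEst β (pulls a (a t ω) (t - 1) ω) (fun u => x (a t ω) u ω)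
          - bonus θ ξ η α t (pulls a (a t ω) (t - 1) ω)
        ≤ ermEst β (pulls a i (t - 1) ω) (fun u => x i u ω)
          - bonus θ ξ η α t (pulls a i (t - 1) ω)) :
    ∀ n : ℕ, sInf {t : ℕ | 1 ≤ t ∧ Athresh θ ξ η α Δmin t ≤ t} ≤ n →
      ∀ xx : ℝ, 1 ≤ xx →
        P {ω | ((n : ℝ) ^ η + 2 * (R + (Real.exp (2 * β * R) - 1) / (2 * β)) * ((K : ℝ) - 1)
                  * (3 + (Athresh θ ξ η α Δmin n : ℝ))) * xx
              ≤ (n : ℝ) * ((1 / (n : ℝ)) * ∑ i, (pulls a i n ω : ℝ) *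
                  ermEst β (pulls a i n ω) (fun t => x i t ω)) - (n : ℝ) * μ istar}
          ≤ ENNReal.ofReal (θ / xx ^ ξ + 2 * ((K : ℝ) - 1)
              / ((α - 1) * ((1 + (Athresh θ ξ η α Δmin n : ℝ)) * xx) ^ (α - 1))) ∧
        P {ω | (n : ℝ) * ((1 / (n : ℝ)) * ∑ i, (pulls a i n ω : ℝ) *
                  ermEst β (pulls a i n ω) (fun t => x i t ω)) - (n : ℝ) * μ istar
              ≤ -(((n : ℝ) ^ η + 2 * (R + (Real.exp (2 * β * R) - 1) / (2 * β))
                  * ((K : ℝ) - 1) * (3 + (Athresh θ ξ η α Δmin n : ℝ))) * xx)}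
          ≤ ENNReal.ofReal (θ / xx ^ ξ + 2 * ((K : ℝ) - 1)
              / ((α - 1) * ((1 + (Athresh θ ξ η α Δmin n : ℝ)) * xx) ^ (α - 1))) := by
  intro n _ y hy
  obtain ⟨⟨k, hk, hkΔ⟩, hΔlb⟩ := hΔ
  have hΔ0 : 0 < Δmin := by rw [hkΔ]; exact sub_pos.2 (hstar k hk)
  have hK2 : (2 : ℝ) ≤ K := by
    have h1 := k.2
    have h2 := istar.2
    have h3 : (k : ℕ) ≠ istar := fun h => hk (Fin.ext h)
    exact_mod_cast (show 2 ≤ K by omega)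
  set A := Athresh θ ξ η α Δmin n with hA
  set C := R + (Real.exp (2 * β * R) - 1) / (2 * β) with hC
  set B := 2 / ((α - 1) * ((1 + (A : ℝ)) * y) ^ (α - 1)) with hB
  have hC0 : 0 < C := by
    have : 0 ≤ (Real.exp (2 * β * R) - 1) / (2 * β) :=
      div_nonneg (by linarith [Real.one_le_exp (show 0 ≤ 2 * β * R by positivity)])
        (by positivity)
    linarith
  have hB0 : 0 ≤ B := div_nonneg zero_le_two (mul_nonneg (by linarith) (by positivity))
  have hbound : 2 * ((K : ℝ) - 1) / ((α - 1) * ((1 + (A : ℝ)) * y) ^ (α - 1)) =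
      ((K : ℝ) - 1) * B := by rw [hB]; ring
  have hcard : ((Finset.univ.erase istar).card : ℝ) = (K : ℝ) - 1 := by
    rw [Finset.cast_card_erase_of_mem (Finset.mem_univ _), Finset.card_univ, Fintype.card_fin]
  rw [hbound]
  rcases Nat.eq_zero_or_pos n with rfl | hn
  · have hr : 0 < ((((0 : ℕ) : ℝ) ^ η + 2 * C * ((K : ℝ) - 1) * (3 + (A : ℝ))) * y) := by
      have : 0 < (K : ℝ) - 1 := by linarith
      positivity
    have hlt := hr.not_ge
    have hgt := (neg_lt_zero.2 hr).not_ge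
    simp only [Nat.cast_zero, zero_mul, sub_zero] at hlt hgt ⊢
    simp [hlt, hgt]
  have hn0 : (n : ℝ) ≠ 0 := by positivity
  -- Both tails reduce to a deviation of the optimal arm or an excess of suboptimal pulls.
  have key : ∀ S E : Set Ω, P E ≤ ENNReal.ofReal (θ / y ^ ξ) →
      (∀ ω ∈ S, (∀ i ≠ istar, (pulls a i n ω : ℝ) < (3 + A) * y) → ω ∈ E) →
      P S ≤ ENNReal.ofReal (θ / y ^ ξ + ((K : ℝ) - 1) * B) := by
    intro S E hE hS
    have hcover : S ⊆ E ∪ ⋃ i ∈ Finset.univ.erase istar,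
        {ω | (3 + (A : ℝ)) * y ≤ pulls a i n ω} := by
      intro ω hω
      by_cases h : ∀ i ≠ istar, (pulls a i n ω : ℝ) < (3 + A) * y
      · exact Or.inl (hS ω hω h)
      · push Not at h
        obtain ⟨i, hi, h⟩ := h
        exact Or.inr (Set.mem_biUnion (by simpa using hi) h)
    calc P S ≤ _ := measure_mono hcover
      _ ≤ _ := measure_union_le _ _
      _ ≤ ENNReal.ofReal (θ / y ^ ξ) +
          ∑ i ∈ Finset.univ.erase istar, ENNReal.ofReal B := by
        refine add_le_add hE ((measure_biUnion_finset_le _ _).trans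
          (Finset.sum_le_sum fun i hi => ?_))
        have hi' := Finset.ne_of_mem_erase hi
        exact measure_le_pulls_le P hθ hξ hη1 hα2 hi' hΔ0 (hΔlb ⟨i, hi', rfl⟩)
          (hconcU istar) (hconcL i) hinit hsel n hy
      _ = _ := by
        rw [← ENNReal.ofReal_sum_of_nonneg fun _ _ => hB0, Finset.sum_const, nsmul_eq_mul, hcard,
          ENNReal.ofReal_add (by positivity) (mul_nonneg (by linarith) hB0)]
  have hdiff : ∀ ω, (∀ i ≠ istar, (pulls a i n ω : ℝ) < (3 + A) * y) →
      |(n : ℝ) * ((1 / (n : ℝ)) * ∑ i, (pulls a i n ω : ℝ) *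
          ermEst β (pulls a i n ω) (fun t => x i t ω)) -
        n * ermEst β n (fun t => x istar t ω)| ≤ 2 * C * (((K : ℝ) - 1) * ((3 + A) * y)) := by
    intro ω hω
    rw [← mul_assoc (n : ℝ), mul_one_div_cancel hn0, one_mul]
    refine (abs_sum_pulls_mul_ermEst_sub_le hβ (fun i t => hxbdd i t ω) a istar n).trans ?_
    gcongr
    calc ∑ i ∈ Finset.univ.erase istar, (pulls a i n ω : ℝ)
        ≤ ∑ i ∈ Finset.univ.erase istar, (3 + (A : ℝ)) * y :=
          Finset.sum_le_sum fun i hi => (hω i (Finset.ne_of_mem_erase hi)).le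
      _ = _ := by rw [Finset.sum_const, nsmul_eq_mul, hcard]
  constructor
  · refine key _ _ (hconcU istar n hn y hy) fun ω hω h => ?_
    have := (abs_le.1 (hdiff ω h)).2
    simp only [Set.mem_ofPred_eq] at hω ⊢
    linarith
  · refine key _ _ (hconcL istar n hn y hy) fun ω hω h => ?_
    have := (abs_le.1 (hdiff ω h)).1
    simp only [Set.mem_ofPred_eq] at hω ⊢
    linarith
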